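/- A topological space X is a-submaximal if and only if every subset of X is a-locally closed. -/

import Mathlib

open Set Topology

/-- A set is regular open if it equals the interior of its closure. -/
def RegOpen {X : Type*} [TopologicalSpace X] (U : Set X) : Prop :=
  U = interior (closure U)

/-- The δ-interior of `A`: the union of all regular open sets contained in `A`. -/
def deltaInt {X : Type*} [TopologicalSpace X] (A : Set X) : Set X :=
  ⋃₀ {U : Set X | RegOpen U ∧ U ⊆ A}

/-- The δ-closure of `A`: the complement of the δ-interior of the complement. -/
def deltaCl {X : Type*} [TopologicalSpace X] (A : Set X) : Set X :=
  (deltaInt Aᶜ)ᶜ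

/-- `A` is a-open if `A ⊆ int(cl(δ-int A))`. -/
def AOpen {X : Type*} [TopologicalSpace X] (A : Set X) : Prop :=
  A ⊆ interior (closure (deltaInt A))

/-- `A` is a-closed if its complement is a-open. -/
def AClosed {X : Type*} [TopologicalSpace X] (A : Set X) : Prop :=
  AOpen Aᶜ

/-- `A` is a-locally closed if it is the intersection of an a-open and an a-closed set. -/
def ALocallyClosed {X : Type*} [TopologicalSpace X] (A : Set X) : Prop :=
  ∃ U V : Set X, AOpen U ∧ AClosed V ∧ A = U ∩ V

/-- `A` is e-open if `A ⊆ cl(δ-int A) ∪ int(δ-cl A)`. -/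
def EOpen {X : Type*} [TopologicalSpace X] (A : Set X) : Prop :=
  A ⊆ closure (deltaInt A) ∪ interior (deltaCl A)

/-- `A` is e-closed if its complement is e-open. -/
def EClosed {X : Type*} [TopologicalSpace X] (A : Set X) : Prop :=
  EOpen Aᶜ

/-- `A` is e-locally closed if it is the intersection of an e-open and an e-closed set. -/
def ELocallyClosed {X : Type*} [TopologicalSpace X] (A : Set X) : Prop :=
  ∃ U V : Set X, EOpen U ∧ EClosed V ∧ A = U ∩ V

/-- The a-closure of `A`: the intersection of all a-closed supersets of `A`. -/
def aCl {X : Type*} [TopologicalSpace X] (A : Set X) : Set X :=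
  ⋂₀ {F : Set X | AClosed F ∧ A ⊆ F}

/-- The a-interior of `A`: the union of all a-open subsets of `A`. -/
def aInt {X : Type*} [TopologicalSpace X] (A : Set X) : Set X :=
  ⋃₀ {U : Set X | AOpen U ∧ U ⊆ A}

/-- The e-closure of `A`: the intersection of all e-closed supersets of `A`. -/
def eCl {X : Type*} [TopologicalSpace X] (A : Set X) : Set X :=
  ⋂₀ {F : Set X | EClosed F ∧ A ⊆ F}

/-- `S` is semi-open if `S ⊆ cl(int S)`. -/
def SemiOpen {X : Type*} [TopologicalSpace X] (S : Set X) : Prop :=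
  S ⊆ closure (interior S)

/-- `S` is semi-closed if its complement is semi-open. -/
def SemiClosed {X : Type*} [TopologicalSpace X] (S : Set X) : Prop :=
  SemiOpen Sᶜ

/-- The semi-closure of `U`: the intersection of all semi-closed supersets of `U`. -/
def sCl {X : Type*} [TopologicalSpace X] (U : Set X) : Set X :=
  ⋂₀ {F : Set X | SemiClosed F ∧ U ⊆ F}

/-- `A` is feebly open if there is an open `U` with `U ⊆ A ⊆ scl(U)`. -/
def FeeblyOpen {X : Type*} [TopologicalSpace X] (A : Set X) : Prop :=
  ∃ U : Set X, IsOpen U ∧ U ⊆ A ∧ A ⊆ sCl U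

/-- `A` is feebly closed if its complement is feebly open. -/
def FeeblyClosed {X : Type*} [TopologicalSpace X] (A : Set X) : Prop :=
  FeeblyOpen Aᶜ

/-- `A` is feebly locally closed if it is the intersection of a feebly open and a
feebly closed set. -/
def FeeblyLocallyClosed {X : Type*} [TopologicalSpace X] (A : Set X) : Prop :=
  ∃ U V : Set X, FeeblyOpen U ∧ FeeblyClosed V ∧ A = U ∩ V

/-- `A` is α-open if `A ⊆ int(cl(int A))`. -/
def AlphaOpen {X : Type*} [TopologicalSpace X] (A : Set X) : Prop :=
  A ⊆ interior (closure (interior A))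

/-- `A` is α-closed if its complement is α-open. -/
def AlphaClosed {X : Type*} [TopologicalSpace X] (A : Set X) : Prop :=
  AlphaOpen Aᶜ

/-- `A` is α-locally closed if it is the intersection of an α-open and an α-closed set. -/
def AlphaLocallyClosed {X : Type*} [TopologicalSpace X] (A : Set X) : Prop :=
  ∃ U V : Set X, AlphaOpen U ∧ AlphaClosed V ∧ A = U ∩ V

/-- `X` is submaximal if every dense subset of `X` is open. -/
def Submaximal (X : Type*) [TopologicalSpace X] : Prop :=
  ∀ A : Set X, closure A = univ → IsOpen A

/-- `X` is a-submaximal if every a-dense subset of `X` is a-open. -/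
def ASubmaximal (X : Type*) [TopologicalSpace X] : Prop :=
  ∀ A : Set X, aCl A = univ → AOpen A

/-- `X` is e-submaximal if every e-dense subset of `X` is e-open. -/
def ESubmaximal (X : Type*) [TopologicalSpace X] : Prop :=
  ∀ A : Set X, eCl A = univ → EOpen A

/-- `X` is an e-space if a subset is open precisely when it is e-open. -/
def IsESpace (X : Type*) [TopologicalSpace X] : Prop :=
  ∀ A : Set X, IsOpen A ↔ EOpen A

theorem deltaInt_mono_aux {X : Type*} [TopologicalSpace X] {A B : Set X} (h : A ⊆ B) :
    deltaInt A ⊆ deltaInt B := by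
  rintro x ⟨U, ⟨hU, hUA⟩, hx⟩
  exact ⟨U, ⟨hU, hUA.trans h⟩, hx⟩

theorem aClosed_aCl_aux {X : Type*} [TopologicalSpace X] (A : Set X) : AClosed (aCl A) := by
  intro x hx
  have hx' : ∃ F : Set X, AClosed F ∧ A ⊆ F ∧ x ∉ F := by
    by_contra hc
    push Not at hc
    exact hx fun F hF => hc F hF.1 hF.2
  obtain ⟨F, hF, hAF, hxF⟩ := hx'
  have hsub : Fᶜ ⊆ (aCl A)ᶜ := compl_subset_compl.2 (sInter_subset_of_mem ⟨hF, hAF⟩)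
  exact interior_mono (closure_mono (deltaInt_mono_aux hsub)) (hF hxF)

theorem subset_aCl_aux {X : Type*} [TopologicalSpace X] (A : Set X) : A ⊆ aCl A :=
  subset_sInter fun _ hF => hF.2

theorem aSubmaximal_iff_all_aLocallyClosed (X : Type*) [TopologicalSpace X] :
    ASubmaximal X ↔ ∀ A : Set X, ALocallyClosed A := by
  constructor
  · intro h A
    refine ⟨A ∪ (aCl A)ᶜ, aCl A, h _ ?_, aClosed_aCl_aux A, ?_⟩
    · refine eq_univ_of_forall fun x F hF => ?_
      by_cases hx : x ∈ aCl A
      · exact hx F ⟨hF.1, subset_union_left.trans hF.2⟩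
      · exact hF.2 (Or.inr hx)
    · ext x
      have := @subset_aCl_aux X _ A x
      simp only [mem_inter_iff, mem_union, mem_compl_iff]
      tauto
  · intro h A hA
    obtain ⟨U, V, hU, hV, hUV⟩ := h A
    have hVu : V = univ := by
      apply eq_univ_of_univ_subset
      rw [← hA]
      exact sInter_subset_of_mem ⟨hV, hUV ▸ inter_subset_right⟩
    rw [hUV, hVu, inter_univ]
    exact hU
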